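/- arXiv:2602.11333 — 2 statements merged into one kernel-verified Lean document; each statement's English description precedes it below -/
import Mathlib

section
/- Let K ≥ 1 and let N₁ ≥ N₂ ≥ ⋯ ≥ N_K ≥ 1 be integers. Then the product index set [N₁] × [N₂] × ⋯ × [N_K] can be partitioned into exactly N₁·N₂⋯N_{K−1} subsets, each of cardinality N_K, such that every subset G of the partition is transversal, i.e., any two distinct K-tuples (i₁,…,i_K) and (i₁′,…,i_K′) belonging to the same subset G satisfy i_k ≠ i_k′ for every coordinate k ∈ {1,…,K}. -/
section DiagonalLine

variable {ι : Type*} {N : ι → ℕ} [∀ k, NeZero (N k)]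

/-- The diagonal direction: the tuple whose entries are all `t`, reduced modulo `N k`. -/
def diagonalShift (N : ι → ℕ) [∀ k, NeZero (N k)] (t : ℕ) : ∀ k, Fin (N k) :=
  fun k => Fin.ofNat (N k) t

/-- The `m` successive diagonal translates of the tuple `a`. -/
def diagonalLine [Fintype ι] (m : ℕ) (a : ∀ k, Fin (N k)) : Finset (∀ k, Fin (N k)) :=
  (Finset.range m).image fun t => a + diagonalShift N t

theorem diagonalShift_apply_injOn {m : ℕ} {k : ι} (hm : m ≤ N k) {s t : ℕ} (hs : s < m)
    (ht : t < m) (h : diagonalShift N s k = diagonalShift N t k) : s = t := by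
  have h' := congrArg Fin.val h
  simpa [diagonalShift, Nat.mod_eq_of_lt (hs.trans_le hm), Nat.mod_eq_of_lt (ht.trans_le hm)]
    using h'

theorem diagonalShift_val (l : ι) (x : Fin (N l)) : diagonalShift N x l = x := by
  simp [diagonalShift]

variable [Fintype ι]

theorem apply_ne_of_mem_diagonalLine {m : ℕ} {a x y : ∀ k, Fin (N k)} (hm : ∀ k, m ≤ N k)
    (hx : x ∈ diagonalLine m a) (hy : y ∈ diagonalLine m a) (hxy : x ≠ y) (k : ι) :
    x k ≠ y k := by
  obtain ⟨s, hs, rfl⟩ := Finset.mem_image.1 hx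
  obtain ⟨t, ht, rfl⟩ := Finset.mem_image.1 hy
  intro h
  refine hxy ?_
  rw [diagonalShift_apply_injOn (hm k) (Finset.mem_range.1 hs) (Finset.mem_range.1 ht)
    (add_left_cancel h)]

theorem card_diagonalLine {m : ℕ} (a : ∀ k, Fin (N k)) (l : ι) (hm : m ≤ N l) :
    (diagonalLine m a).card = m := by
  rw [diagonalLine, Finset.card_image_of_injOn, Finset.card_range]
  intro s hs t ht h
  exact diagonalShift_apply_injOn hm (Finset.mem_range.1 hs) (Finset.mem_range.1 ht)
    (congrFun (add_left_cancel h) l)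

/-- A tuple lies on exactly one diagonal line whose base point vanishes at coordinate `l`. -/
theorem mem_diagonalLine_iff {l : ι} {a x : ∀ k, Fin (N k)} (ha : a l = 0) :
    x ∈ diagonalLine (N l) a ↔ a = x - diagonalShift N (x l) := by
  constructor
  · intro hx
    obtain ⟨t, ht, rfl⟩ := Finset.mem_image.1 hx
    have hval : ((a + diagonalShift N t) l : ℕ) = t := by
      simp [ha, diagonalShift, Nat.mod_eq_of_lt (Finset.mem_range.1 ht)]
    rw [hval, add_sub_cancel_right]
  · intro h
    exact Finset.mem_image.2 ⟨x l, Finset.mem_range.2 (x l).isLt, by rw [h, sub_add_cancel]⟩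

end DiagonalLine


/-- **Transversal partition of a multi-index set.**
Let `K ≥ 1` and `N 0 ≥ N 1 ≥ ⋯ ≥ N (K-1) ≥ 1`.  Then the product index set
`Fin (N 0) × ⋯ × Fin (N (K-1))` can be partitioned into exactly
`N 0 · N 1 ⋯ N (K-2)` subsets, each of cardinality `N (K-1)`, such that every
subset `G` of the partition is transversal: any two distinct tuples in `G`
differ in every coordinate. -/
theorem transversal_partition
    (K : ℕ) (hK : 1 ≤ K) (N : Fin K → ℕ)
    (hmono : ∀ i j : Fin K, i ≤ j → N j ≤ N i)
    (hpos : ∀ k, 1 ≤ N k) :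
    ∃ P : Finset (Finset (∀ k : Fin K, Fin (N k))),
      (∀ G ∈ P, G.card = N ⟨K - 1, by omega⟩) ∧
      P.card = ∏ k : Fin K, (if (k : ℕ) < K - 1 then N k else 1) ∧
      (∀ G ∈ P, ∀ G' ∈ P, G ≠ G' → Disjoint G G') ∧
      P.sup id = Finset.univ ∧
      (∀ G ∈ P, ∀ x ∈ G, ∀ y ∈ G, x ≠ y → ∀ k : Fin K, x k ≠ y k) := by
  have : ∀ k, NeZero (N k) := fun k => ⟨Nat.one_le_iff_ne_zero.1 (hpos k)⟩
  set l : Fin K := ⟨K - 1, by omega⟩ with hl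
  have hmin : ∀ k, N l ≤ N k := fun k => hmono k l (Fin.le_def.2 (by simp only [hl]; omega))
  let B : Finset (∀ k, Fin (N k)) :=
    Fintype.piFinset fun k => if (k : ℕ) < K - 1 then Finset.univ else {0}
  have hB : ∀ a, a ∈ B ↔ a l = 0 := by
    intro a
    rw [Fintype.mem_piFinset]
    constructor
    · intro h
      simpa [hl] using h l
    · intro h k
      split_ifs with hk
      · exact Finset.mem_univ _
      · obtain rfl : k = l := Fin.ext (by simp only [hl]; omega)
        exact Finset.mem_singleton.2 h
  have huniq : ∀ a ∈ B, ∀ b ∈ B, ∀ x, x ∈ diagonalLine (N l) a → x ∈ diagonalLine (N l) b →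
      a = b := fun a ha b hb x hxa hxb =>
    ((mem_diagonalLine_iff ((hB a).1 ha)).1 hxa).trans
      ((mem_diagonalLine_iff ((hB b).1 hb)).1 hxb).symm
  refine ⟨B.image (diagonalLine (N l)), ?_, ?_, ?_, ?_, ?_⟩
  · exact Finset.forall_mem_image.2 fun a _ => card_diagonalLine a l le_rfl
  · rw [Finset.card_image_of_injOn, Fintype.card_piFinset]
    · refine Finset.prod_congr rfl fun k _ => ?_
      split_ifs <;> simp
    · intro a ha b hb hab
      obtain ⟨x, hx⟩ : (diagonalLine (N l) a).Nonempty := by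
        rw [← Finset.card_pos, card_diagonalLine a l le_rfl]
        exact hpos l
      exact huniq a ha b hb x hx (hab ▸ hx)
  · refine Finset.forall_mem_image.2 fun a ha => Finset.forall_mem_image.2 fun b hb hab => ?_
    refine Finset.disjoint_left.2 fun x hxa hxb => hab ?_
    rw [huniq a ha b hb x hxa hxb]
  · refine Finset.eq_univ_of_forall fun x => ?_
    have hbase : (x - diagonalShift N (x l)) l = 0 := by
      rw [Pi.sub_apply, diagonalShift_val, sub_self]
    exact Finset.mem_sup.2 ⟨_, Finset.mem_image_of_mem _ ((hB _).2 hbase),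
      (mem_diagonalLine_iff hbase).2 rfl⟩
  · exact Finset.forall_mem_image.2 fun a _ x hx y hy hxy k =>
      apply_ne_of_mem_diagonalLine hmin hx hy hxy k
end

section
/- Let h : (0,∞) → [0,∞) be a non-increasing function that is integrable on (0, δ) for every δ > 0, and define J(δ) = ∫₀^δ h(τ) dτ for δ ≥ 0. Then the map (x, y) ↦ √y · J(√(x/y)) is jointly concave on [0,∞) × (0,∞). -/
open MeasureTheory

/-- The primitive of an antitone function on `(0, ∞)` lies below its supporting line of
slope `h t` at `t`. -/
theorem setIntegral_Ioo_le_add_mul_sub_of_antitoneOn {h : ℝ → ℝ}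
    (h_anti : AntitoneOn h (Set.Ioi (0 : ℝ)))
    (h_int : ∀ δ : ℝ, 0 < δ → IntegrableOn h (Set.Ioo 0 δ) volume)
    {s t : ℝ} (hs : 0 ≤ s) (ht : 0 < t) :
    ∫ τ in Set.Ioo (0 : ℝ) s, h τ ≤ (∫ τ in Set.Ioo (0 : ℝ) t, h τ) + h t * (s - t) := by
  have hI : ∀ u, 0 ≤ u → IntervalIntegrable h volume 0 u := fun u hu => by
    rw [intervalIntegrable_iff_integrableOn_Ioo_of_le hu]
    exact (h_int (u + 1) (by linarith)).mono_set (Set.Ioo_subset_Ioo_right (by linarith))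
  have hII : ∀ u v, 0 ≤ u → 0 ≤ v → IntervalIntegrable h volume u v := fun u v hu hv =>
    (hI u hu).symm.trans (hI v hv)
  rw [← integral_Ioc_eq_integral_Ioo, ← integral_Ioc_eq_integral_Ioo,
    ← intervalIntegral.integral_of_le hs, ← intervalIntegral.integral_of_le ht.le]
  rcases le_total t s with hts | hst
  · have hle : ∫ τ in t..s, h τ ≤ ∫ _ in t..s, h t :=
      intervalIntegral.integral_mono_on hts (hII t s ht.le hs) intervalIntegrable_const
        fun x hx => h_anti ht (ht.trans_le hx.1) hx.1
    rw [intervalIntegral.integral_const, smul_eq_mul] at hle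
    linarith [intervalIntegral.integral_add_adjacent_intervals (hI t ht.le) (hII t s ht.le hs)]
  · have hle : ∫ _ in s..t, h t ≤ ∫ τ in s..t, h τ :=
      intervalIntegral.integral_mono_on_of_le_Ioo hst intervalIntegrable_const
        (hII s t hs ht.le) fun x hx => h_anti (hs.trans_lt hx.1) ht hx.2.le
    rw [intervalIntegral.integral_const, smul_eq_mul] at hle
    linarith [intervalIntegral.integral_add_adjacent_intervals (hI s hs) (hII s t hs ht.le)]

/-- **Joint concavity of `(x, y) ↦ √y · J(√(x/y))`.**
Let `h : (0,∞) → [0,∞)` be non-increasing and integrable on `(0, δ)` for every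
`δ > 0`, and let `J δ = ∫_0^δ h(τ) dτ` for `δ ≥ 0`.  Then the map
`(x, y) ↦ √y · J (√(x/y))` is jointly concave on `[0,∞) × (0,∞)`. -/
theorem entropy_integral_joint_concavity
    (h : ℝ → ℝ)
    (h_nonneg : ∀ x, 0 < x → 0 ≤ h x)
    (h_anti : AntitoneOn h (Set.Ioi (0 : ℝ)))
    (h_int : ∀ δ : ℝ, 0 < δ → IntegrableOn h (Set.Ioo 0 δ) volume)
    (J : ℝ → ℝ)
    (hJ : ∀ δ : ℝ, 0 ≤ δ → J δ = ∫ τ in Set.Ioo (0 : ℝ) δ, h τ) :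
    ConcaveOn ℝ (Set.Ici (0 : ℝ) ×ˢ Set.Ioi (0 : ℝ))
      (fun p : ℝ × ℝ => Real.sqrt p.2 * J (Real.sqrt (p.1 / p.2))) := by
  have hJ0 : J 0 = 0 := by simp [hJ 0 le_rfl]
  have hconv : Convex ℝ (Set.Ici (0 : ℝ) ×ˢ Set.Ioi (0 : ℝ)) :=
    (convex_Ici 0).prod (convex_Ioi 0)
  refine ⟨hconv, ?_⟩
  rintro ⟨x₁, y₁⟩ hp ⟨x₂, y₂⟩ hq a b ha hb hab
  obtain ⟨hx, hy⟩ := hconv hp hq ha hb hab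
  have hsqrt := Real.strictConcaveOn_sqrt.concaveOn.2
  obtain ⟨hx₁, hy₁⟩ := hp
  obtain ⟨hx₂, hy₂⟩ := hq
  have hsx := hsqrt hx₁ hx₂ ha hb hab
  have hsy := hsqrt (Set.mem_Ioi.1 hy₁).le (Set.mem_Ioi.1 hy₂).le ha hb hab
  simp only [Prod.smul_mk, Prod.mk_add_mk, smul_eq_mul, Set.mem_Ici, Set.mem_Ioi]
    at hx hy hx₁ hy₁ hx₂ hy₂ hsx hsy ⊢
  rcases hx.eq_or_lt with hx0 | hx0
  · have hvanish : ∀ c x y : ℝ, c * x = 0 → c * (√y * J √(x / y)) = 0 := by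
      intro c x y hcx
      rcases mul_eq_zero.1 hcx with rfl | rfl <;> simp [hJ0]
    have hax := mul_nonneg ha hx₁
    have hbx := mul_nonneg hb hx₂
    rw [hvanish a x₁ y₁ (by linarith), hvanish b x₂ y₂ (by linarith), ← hx0]
    simp [hJ0]
  · generalize a * x₁ + b * x₂ = x at *
    generalize a * y₁ + b * y₂ = y at *
    have ht : 0 < √(x / y) := Real.sqrt_pos.2 (div_pos hx0 hy)
    have hxt : √x = √y * √(x / y) := by
      rw [← Real.sqrt_mul hy.le, mul_div_cancel₀ _ hy.ne']
    generalize √(x / y) = t at *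
    have hc := h_nonneg t ht
    have hsupp : ∀ s, 0 ≤ s → J s ≤ J t + h t * (s - t) := fun s hs => by
      rw [hJ s hs, hJ t ht.le]
      exact setIntegral_Ioo_le_add_mul_sub_of_antitoneOn h_anti h_int hs ht
    have hscaled : ∀ u v : ℝ, 0 < v →
        √v * J √(u / v) ≤ √v * (J t - h t * t) + h t * √u := by
      intro u v hv
      have huv : √u = √v * √(u / v) := by
        rw [← Real.sqrt_mul hv.le, mul_div_cancel₀ _ hv.ne']
      rw [huv]
      nlinarith [mul_le_mul_of_nonneg_left (hsupp √(u / v) (Real.sqrt_nonneg _))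
        (Real.sqrt_nonneg v)]
    have hint : 0 ≤ J t - h t * t := by linarith [hsupp 0 le_rfl]
    calc a * (√y₁ * J √(x₁ / y₁)) + b * (√y₂ * J √(x₂ / y₂))
        ≤ a * (√y₁ * (J t - h t * t) + h t * √x₁)
          + b * (√y₂ * (J t - h t * t) + h t * √x₂) := by
          gcongr
          · exact hscaled x₁ y₁ hy₁
          · exact hscaled x₂ y₂ hy₂
      _ = (a * √y₁ + b * √y₂) * (J t - h t * t) + h t * (a * √x₁ + b * √x₂) := by ring
      _ ≤ √y * (J t - h t * t) + h t * √x := by gcongr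
      _ = √y * J t := by rw [hxt]; ring
end
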